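/- arXiv:2211.16030 — 2 statements merged into one kernel-verified Lean document; each statement's English description precedes it below -/
import Mathlib

section
/- For the pointwise comparison of the segregation projection P and the segregation map G defined by (Gu)_i = max(u_i − Σ_{j≠i} u_j, 0), applied to a k-tuple u of nonnegative functions on a finite graph: ‖Pu − u‖ ≤ ‖Gu − u‖ ≤ √k · ‖Pu − u‖. -/
open Finset

lemma pointwise_aux (k : ℕ) (u p g : Fin k → ℝ) (hu : ∀ i, 0 ≤ u i)
    (hP : ∃ i : Fin k, (∀ j, max (u j) 0 ≤ max (u i) 0) ∧
      p i = max (u i) 0 ∧ ∀ j, j ≠ i → p j = 0)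
    (hG : ∀ i, g i = max (u i - ∑ j ∈ Finset.univ.erase i, u j) 0) :
    ∑ i, (p i - u i) ^ 2 ≤ ∑ i, (g i - u i) ^ 2 ∧
    ∑ i, (g i - u i) ^ 2 ≤ (k : ℝ) * ∑ i, (p i - u i) ^ 2 := by
  obtain ⟨m, hm, hpm, hp⟩ := hP
  have hm' : ∀ j, u j ≤ u m := fun j => by
    have := hm j
    rwa [max_eq_left (hu j), max_eq_left (hu m)] at this
  rw [max_eq_left (hu m)] at hpm
  have hg0 : ∀ i, i ≠ m → g i = 0 := fun i hi => by
    rw [hG i]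
    apply max_eq_right
    have h1 : u m ≤ ∑ j ∈ Finset.univ.erase i, u j :=
      Finset.single_le_sum (f := u) (fun j _ => hu j) (by simp [hi.symm])
    linarith [hm' i]
  have hsP : ∑ i, (p i - u i) ^ 2 = ∑ i ∈ Finset.univ.erase m, (u i) ^ 2 := by
    rw [← Finset.add_sum_erase _ _ (Finset.mem_univ m), hpm]
    simp only [sub_self, ne_eq, OfNat.ofNat_ne_zero, not_false_eq_true, zero_pow, zero_add]
    refine Finset.sum_congr rfl fun i hi => ?_
    rw [hp i (Finset.ne_of_mem_erase hi)]; ring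
  have hsG : ∑ i, (g i - u i) ^ 2 =
      (g m - u m) ^ 2 + ∑ i ∈ Finset.univ.erase m, (u i) ^ 2 := by
    rw [← Finset.add_sum_erase _ _ (Finset.mem_univ m)]
    congr 1
    refine Finset.sum_congr rfl fun i hi => ?_
    rw [hg0 i (Finset.ne_of_mem_erase hi)]; ring
  rw [hsP, hsG]
  refine ⟨by linarith [sq_nonneg (g m - u m)], ?_⟩
  have hS : 0 ≤ ∑ j ∈ Finset.univ.erase m, u j := Finset.sum_nonneg fun j _ => hu j
  have h2 : (g m - u m) ^ 2 ≤ (∑ j ∈ Finset.univ.erase m, u j) ^ 2 := by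
    apply sq_le_sq'
    · rw [hG m]
      linarith [le_max_left (u m - ∑ j ∈ Finset.univ.erase m, u j) 0]
    · have : g m ≤ u m := by
        rw [hG m]; exact max_le (by linarith) (hu m)
      linarith
  have h3 := sq_sum_le_card_mul_sum_sq (s := Finset.univ.erase m) (f := u)
  have h4 : (((Finset.univ.erase m).card : ℕ) : ℝ) + 1 = k := by
    have := Finset.card_erase_add_one (Finset.mem_univ m)
    rw [Finset.card_univ, Fintype.card_fin] at this
    exact_mod_cast this
  rw [← h4]
  linarith

theorem stmt_8 {X : Type*} [Fintype X] (k : ℕ)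
    (u Pu : Fin k → X → ℝ) (hu : ∀ i x, 0 ≤ u i x)
    (hP : ∀ x : X, ∃ i : Fin k,
      (∀ j, max (u j x) 0 ≤ max (u i x) 0) ∧
      Pu i x = max (u i x) 0 ∧ ∀ j, j ≠ i → Pu j x = 0)
    (Gu : Fin k → X → ℝ)
    (hG : ∀ i x, Gu i x = max (u i x - ∑ j ∈ Finset.univ.erase i, u j x) 0) :
    Real.sqrt (∑ i, ∑ x, (Pu i x - u i x) ^ 2)
      ≤ Real.sqrt (∑ i, ∑ x, (Gu i x - u i x) ^ 2) ∧
    Real.sqrt (∑ i, ∑ x, (Gu i x - u i x) ^ 2)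
      ≤ Real.sqrt (k : ℝ) * Real.sqrt (∑ i, ∑ x, (Pu i x - u i x) ^ 2) := by
  have key := fun x => pointwise_aux k (fun i => u i x) (fun i => Pu i x) (fun i => Gu i x)
    (fun i => hu i x) (hP x) (fun i => hG i x)
  rw [Finset.sum_comm (f := fun i x => (Pu i x - u i x) ^ 2),
    Finset.sum_comm (f := fun i x => (Gu i x - u i x) ^ 2)]
  refine ⟨Real.sqrt_le_sqrt (Finset.sum_le_sum fun x _ => (key x).1), ?_⟩
  rw [← Real.sqrt_mul (Nat.cast_nonneg k), Finset.mul_sum]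
  exact Real.sqrt_le_sqrt (Finset.sum_le_sum fun x _ => (key x).2)
end

section
/- Let (u_1,…,u_k) be a minimizer of the functional J(u) = ½ Σ_i ‖∇u_i‖² − Σ_{i<j} (∇u_i, ∇u_j) over the segregated admissible set K on a finite connected graph. Then with û_i := u_i − Σ_{j≠i} u_j: (a) L û_i(x) = 0 whenever u_i(x) > 0 and x ∉ Γ; (b) L û_i(x) ≥ 0 for every x ∈ X \ Γ. -/
open Finset

noncomputable def lap {X : Type*} [Fintype X] (w : X → X → ℝ) (u : X → ℝ) (x : X) : ℝ :=
  ∑ y, w x y * (u x - u y)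

noncomputable def din {X : Type*} [Fintype X] (w : X → X → ℝ) (u v : X → ℝ) : ℝ :=
  (1 / 2) * ∑ x, ∑ y, w x y * (u y - u x) * (v y - v x)

noncomputable def Jseg {X : Type*} [Fintype X] (w : X → X → ℝ) {k : ℕ}
    (u : Fin k → X → ℝ) : ℝ :=
  (1 / 2) * ∑ i, din w (u i) (u i) -
    ∑ i, ∑ j ∈ Finset.univ.filter (fun j => i < j), din w (u i) (u j)

def Adm {X : Type*} {k : ℕ} (Γ : Set X) (φ : Fin k → X → ℝ) (u : Fin k → X → ℝ) : Prop :=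
  (∀ i, ∀ x ∈ Γ, u i x = φ i x) ∧ (∀ i x, 0 ≤ u i x) ∧
    (∀ i j, i ≠ j → ∀ x, u i x * u j x = 0)

noncomputable def hat {X : Type*} [Fintype X] {k : ℕ} (u : Fin k → X → ℝ)
    (i : Fin k) (x : X) : ℝ :=
  u i x - ∑ j ∈ Finset.univ.erase i, u j x


lemma din_comm' {X : Type*} [Fintype X] (w : X → X → ℝ) (u v : X → ℝ) :
    din w u v = din w v u := by
  unfold din
  congr 1
  refine sum_congr rfl fun x _ => sum_congr rfl fun y _ => by ring

lemma din_add_left' {X : Type*} [Fintype X] (w : X → X → ℝ) (u v z : X → ℝ) :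
    din w (fun x => u x + v x) z = din w u z + din w v z := by
  unfold din
  rw [← mul_add, ← sum_add_distrib]
  congr 1
  refine sum_congr rfl fun x _ => ?_
  rw [← sum_add_distrib]
  exact sum_congr rfl fun y _ => by ring

lemma din_smul_left' {X : Type*} [Fintype X] (w : X → X → ℝ) (t : ℝ) (v z : X → ℝ) :
    din w (fun x => t * v x) z = t * din w v z := by
  unfold din
  rw [mul_left_comm]
  congr 1
  rw [mul_sum]
  refine sum_congr rfl fun x _ => ?_
  rw [mul_sum]
  exact sum_congr rfl fun y _ => by ring

lemma din_sum_left' {X ι : Type*} [Fintype X] (w : X → X → ℝ) (s : Finset ι)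
    (u : ι → X → ℝ) (z : X → ℝ) :
    din w (fun x => ∑ i ∈ s, u i x) z = ∑ i ∈ s, din w (u i) z := by
  classical
  induction s using Finset.induction_on with
  | empty => simp [din]
  | insert a s ha ih =>
    rw [sum_insert ha, ← ih, ← din_add_left']
    simp only [sum_insert ha]

lemma din_quad {X : Type*} [Fintype X] (w : X → X → ℝ) (t : ℝ) (v z : X → ℝ) :
    din w (fun x => v x + t * z x) (fun x => v x + t * z x)
      = din w v v + 2 * t * din w v z + t ^ 2 * din w z z := by
  rw [din_add_left', din_smul_left', din_comm' w v, din_comm' w z, din_add_left', din_add_left',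
    din_smul_left', din_smul_left', din_comm' w z v]
  ring

lemma din_single {X : Type*} [Fintype X] [DecidableEq X] (w : X → X → ℝ)
    (hsym : ∀ x y, w x y = w y x) (u : X → ℝ) (x : X) :
    din w u (fun y => if y = x then 1 else 0) = lap w u x := by
  unfold din lap
  have h1 : ∑ a, ∑ b, w a b * (u b - u a) * ((if b = x then (1:ℝ) else 0) - if a = x then 1 else 0)
      = ∑ a, ∑ b, (if b = x then w a b * (u b - u a) else 0)
        - ∑ a, ∑ b, (if a = x then w a b * (u b - u a) else 0) := by
    rw [← sum_sub_distrib]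
    refine sum_congr rfl fun a _ => ?_
    rw [← sum_sub_distrib]
    refine sum_congr rfl fun b _ => ?_
    split_ifs <;> ring
  rw [h1, sum_comm (f := fun a b => if a = x then w a b * (u b - u a) else 0)]
  simp only [sum_ite_eq', mem_univ, if_true]
  rw [← sum_sub_distrib, mul_sum]
  refine sum_congr rfl fun a _ => ?_
  rw [hsym a x]; ring

lemma Jseg_eq {X : Type*} [Fintype X] (w : X → X → ℝ) {k : ℕ} (u : Fin k → X → ℝ) :
    Jseg w u = ∑ i, din w (u i) (u i)
      - (1 / 2) * din w (fun x => ∑ i, u i x) (fun x => ∑ i, u i x) := by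
  have h : din w (fun x => ∑ i, u i x) (fun x => ∑ i, u i x)
      = ∑ i, ∑ j, din w (u i) (u j) := by
    rw [din_sum_left']
    refine sum_congr rfl fun i _ => ?_
    rw [din_comm', din_sum_left']
    exact sum_congr rfl fun j _ => din_comm' _ _ _
  have h2 : ∑ i, ∑ j, din w (u i) (u j)
      = ∑ i, din w (u i) (u i) + ∑ i, ∑ j, (if i < j then din w (u i) (u j) else 0)
        + ∑ i, ∑ j, (if j < i then din w (u i) (u j) else 0) := by
    rw [← sum_add_distrib, ← sum_add_distrib]
    refine sum_congr rfl fun i _ => ?_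
    have : din w (u i) (u i) = ∑ j, if i = j then din w (u i) (u j) else 0 := by simp
    rw [this, ← sum_add_distrib, ← sum_add_distrib]
    refine sum_congr rfl fun j _ => ?_
    rcases lt_trichotomy i j with h | h | h
    · simp [h, h.ne, h.not_gt]
    · subst h; simp
    · simp [h, h.ne', h.not_gt]
  have h3 : ∑ i, ∑ j, (if j < i then din w (u i) (u j) else 0)
      = ∑ i, ∑ j, (if i < j then din w (u i) (u j) else 0) := by
    rw [sum_comm]
    refine sum_congr rfl fun i _ => sum_congr rfl fun j _ => ?_
    rw [din_comm']
  rw [h, h2, h3]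
  unfold Jseg
  simp only [sum_filter]
  ring

lemma hat_eq {X : Type*} [Fintype X] {k : ℕ} (u : Fin k → X → ℝ) (i : Fin k) (x : X) :
    hat u i x = 2 * u i x - ∑ j, u j x := by
  unfold hat
  rw [← add_sum_erase univ (fun j => u j x) (mem_univ i)]
  ring

lemma Jseg_pert {X : Type*} [Fintype X] [DecidableEq X] (w : X → X → ℝ)
    (hsym : ∀ x y, w x y = w y x) {k : ℕ} (u : Fin k → X → ℝ) (i : Fin k) (x : X) (t : ℝ) :
    Jseg w (Function.update u i (fun y => u i y + t * if y = x then 1 else 0))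
      = Jseg w u + (t * lap w (hat u i) x
        + t ^ 2 * ((1 / 2) * din w (fun y => if y = x then 1 else 0)
            (fun y => if y = x then 1 else 0))) := by
  set δ : X → ℝ := fun y => if y = x then 1 else 0 with hδ
  set v := Function.update u i (fun y => u i y + t * if y = x then 1 else 0) with hv
  have hvi : v i = fun y => u i y + t * δ y := by simp [hv, hδ]
  have hvj : ∀ j, j ≠ i → v j = u j := fun j hj => by simp [hv, hj]
  have hS : (fun y => ∑ j, v j y) = fun y => (fun y => ∑ j, u j y) y + t * δ y := by
    funext y
    beta_reduce
    rw [← add_sum_erase univ (fun j => v j y) (mem_univ i),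
      ← add_sum_erase univ (fun j => u j y) (mem_univ i), hvi,
      sum_congr rfl (fun j hj => by rw [hvj j (ne_of_mem_erase hj)])]
    ring
  have hD : ∑ j, din w (v j) (v j) = ∑ j, din w (u j) (u j)
      + (2 * t * din w (u i) δ + t ^ 2 * din w δ δ) := by
    rw [← add_sum_erase univ (fun j => din w (v j) (v j)) (mem_univ i),
      ← add_sum_erase univ (fun j => din w (u j) (u j)) (mem_univ i), hvi, din_quad,
      sum_congr rfl (fun j hj => by rw [hvj j (ne_of_mem_erase hj)])]
    ring
  have hl : lap w (hat u i) x = 2 * din w (u i) δ - din w (fun y => ∑ j, u j y) δ := by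
    rw [din_single w hsym, din_single w hsym]
    unfold lap
    rw [mul_sum, ← sum_sub_distrib]
    refine sum_congr rfl fun y _ => ?_
    rw [hat_eq, hat_eq]; ring
  rw [Jseg_eq, Jseg_eq, hS, din_quad, hD, hl]
  ring

lemma small_pos (a b ε : ℝ) (hε : 0 < ε)
    (h : ∀ t, 0 ≤ t → t ≤ ε → 0 ≤ t * a + t ^ 2 * b) : 0 ≤ a := by
  by_contra! ha
  have hb : 0 < |b| + 1 := by positivity
  set t := min ε (-a / (2 * (|b| + 1))) with ht
  have ht0 : 0 < t := lt_min hε (div_pos (by linarith) (by linarith))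
  have h1 := h t ht0.le (min_le_left _ _)
  have h2 : t * (2 * (|b| + 1)) ≤ -a := by
    rw [← le_div_iff₀ (by linarith)]; exact min_le_right _ _
  have h3 : t * b ≤ t * (|b| + 1) :=
    mul_le_mul_of_nonneg_left (by linarith [le_abs_self b]) ht0.le
  nlinarith

theorem stmt_15 {X : Type*} [Fintype X] (w : X → X → ℝ)
    (hsym : ∀ x y, w x y = w y x) (hnn : ∀ x y, 0 ≤ w x y)
    (hconn : ∀ x y : X, Relation.ReflTransGen (fun a b => 0 < w a b) x y)
    (k : ℕ) (Γ : Set X) (hΓ : Γ.Nonempty) (φ : Fin k → X → ℝ)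
    (hφ01 : ∀ i, ∀ x ∈ Γ, φ i x = 0 ∨ φ i x = 1)
    (hφseg : ∀ i j, i ≠ j → ∀ x ∈ Γ, φ i x * φ j x = 0)
    (u : Fin k → X → ℝ) (hu : Adm Γ φ u)
    (hmin : ∀ v : Fin k → X → ℝ, Adm Γ φ v → Jseg w u ≤ Jseg w v) :
    (∀ (i : Fin k) (x : X), x ∉ Γ → 0 < u i x → lap w (hat u i) x = 0) ∧
    (∀ (i : Fin k) (x : X), x ∉ Γ → 0 ≤ lap w (hat u i) x) := by

  classical
  obtain ⟨hb, hpos, hseg⟩ := hu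
  have key : ∀ (i : Fin k) (x : X) (t : ℝ), x ∉ Γ → 0 ≤ u i x + t →
      (∀ j, j ≠ i → u j x = 0) →
      0 ≤ t * lap w (hat u i) x
        + t ^ 2 * ((1 / 2) * din w (fun y => if y = x then 1 else 0)
            (fun y => if y = x then 1 else 0)) := by
    intro i x t hx ht hz
    have h := hmin (Function.update u i (fun y => u i y + t * if y = x then 1 else 0)) ?_
    · rw [Jseg_pert w hsym] at h
      linarith
    · have hne : ∀ y, y ≠ x → ∀ j,
          (Function.update u i (fun y => u i y + t * if y = x then 1 else 0)) j y = u j y := by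
        intro y hy j
        by_cases hj : j = i
        · subst hj; simp [hy]
        · simp [hj]
      have hi : (Function.update u i (fun y => u i y + t * if y = x then 1 else 0)) i x
          = u i x + t := by simp
      have hj : ∀ j, j ≠ i →
          (Function.update u i (fun y => u i y + t * if y = x then 1 else 0)) j x = 0 := by
        intro j hj; simp [hj, hz j hj]
      refine ⟨fun j y hy => ?_, fun j y => ?_, fun j l hjl y => ?_⟩
      · rw [hne y (fun h => hx (h ▸ hy)), hb j y hy]
      · by_cases hy : y = x
        · subst hy
          by_cases h : j = i
          · subst h; rw [hi]; exact ht
          · rw [hj j h]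
        · rw [hne y hy]; exact hpos j y
      · by_cases hy : y = x
        · subst hy
          by_cases h : j = i
          · rw [hj l (fun h' => hjl (h.trans h'.symm)), mul_zero]
          · rw [hj j h, zero_mul]
        · rw [hne y hy, hne y hy]; exact hseg j l hjl y
  have hA : ∀ (i : Fin k) (x : X), x ∉ Γ → 0 < u i x → lap w (hat u i) x = 0 := by
    intro i x hx hix
    have hz : ∀ j, j ≠ i → u j x = 0 := fun j hj =>
      (mul_eq_zero.1 (hseg j i hj x)).resolve_right hix.ne'
    apply le_antisymm
    · have := small_pos (-lap w (hat u i) x) _ _ hix (fun t ht0 ht => by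
        have := key i x (-t) hx (by linarith) hz
        rw [neg_sq] at this
        rw [mul_neg, ← neg_mul]
        exact this)
      linarith
    · exact small_pos _ _ 1 one_pos (fun t ht0 _ => key i x t hx (by linarith) hz)
  refine ⟨hA, fun i x hx => ?_⟩
  by_cases hz : ∀ j, j ≠ i → u j x = 0
  · exact small_pos _ _ 1 one_pos (fun t ht0 _ => key i x t hx (by linarith [hpos i x]) hz)
  · push Not at hz
    obtain ⟨j, hji, hjx⟩ := hz
    have hjp : 0 < u j x := lt_of_le_of_ne (hpos j x) (Ne.symm hjx)
    have h0 := hA j x hx hjp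
    have hzl : ∀ l, l ≠ j → u l x = 0 := fun l hl =>
      (mul_eq_zero.1 (hseg l j hl x)).resolve_right hjx
    have hge : 0 ≤ lap w (hat u i) x + lap w (hat u j) x := by
      unfold lap
      rw [← sum_add_distrib]
      refine sum_nonneg fun y _ => ?_
      rw [← mul_add]
      refine mul_nonneg (hnn x y) ?_
      simp only [hat_eq]
      have e1 : ∑ l, u l x = u j x := by
        rw [sum_eq_single j (fun l _ hl => hzl l hl) (by simp)]
      have e2 : u i y + u j y ≤ ∑ l, u l y := by
        rw [← sum_pair (f := fun l => u l y) hji.symm]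
        exact sum_le_sum_of_subset_of_nonneg (subset_univ _) (fun l _ _ => hpos l y)
      rw [e1, hzl i hji.symm]
      linarith
    linarith
end
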